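/- For every finite-dimensional normed space V, the 2-dimensional Busemann–Hausdorff area density A^{bh} : GC₂(V) → ℝ₊ admits a convex extension to Λ²V. -/

import Mathlib

open MeasureTheory

/-- The simple (decomposable) 2-vector `v ∧ w`, as an element of `⋀[ℝ]^2 V`. -/
noncomputable def simpleWedge {V : Type*} [AddCommGroup V] [Module ℝ V] (v w : V) :
    ⋀[ℝ]^2 V :=
  ⟨ExteriorAlgebra.ιMulti ℝ 2 ![v, w],
    ExteriorAlgebra.ιMulti_range ℝ 2 (Set.mem_range_self _)⟩

open Finset in
theorem sum_slope_mul_eq (m s : ℕ → ℝ) (n : ℕ) :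
    ∑ k ∈ range n, s k * m k *
        ((∑ i ∈ range n, m i) - (∑ i ∈ range k, m i) - ∑ i ∈ range (k + 1), m i) =
      -∑ j ∈ range n, ∑ i ∈ range j, m i * m j * (s j - s i) := by
  induction n with
  | zero => simp
  | succ n ih =>
    have h1 : ∀ k, s k * m k * ((∑ i ∈ range (n + 1), m i) - (∑ i ∈ range k, m i)
        - ∑ i ∈ range (k + 1), m i) = s k * m k * ((∑ i ∈ range n, m i) - (∑ i ∈ range k, m i)
        - ∑ i ∈ range (k + 1), m i) + m n * (s k * m k) := by
      intro k
      rw [sum_range_succ _ n]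
      ring
    have h2 : ∑ i ∈ range n, m i * m n * (s n - s i)
        = s n * m n * ∑ i ∈ range n, m i - m n * ∑ i ∈ range n, s i * m i := by
      rw [mul_sum, mul_sum, ← sum_sub_distrib]
      exact sum_congr rfl fun i _ => by ring
    rw [sum_congr rfl fun k _ => h1 k, sum_add_distrib, sum_range_succ, ih, ← mul_sum,
      sum_range_succ (fun j => ∑ i ∈ range j, m i * m j * (s j - s i)), h2]
    simp only [sum_range_succ]
    ring

/-- A planar region lying in the strip `|x| ≤ X` under a function `τ` and above its point
reflection has area at most `2 ∫ τ`. -/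
theorem volume_le_two_mul_integral {K : Set (ℝ × ℝ)} (hK : MeasurableSet K) {X : ℝ} (hX : 0 ≤ X)
    {τ : ℝ → ℝ} (hτ : Continuous τ) (hsymm : ∀ x ∈ K, -x ∈ K) (hKX : ∀ x ∈ K, x.1 ≤ X)
    (hKτ : ∀ x ∈ K, x.2 ≤ τ x.1) (hτ0 : ∀ x ∈ Set.Icc (-X) X, 0 ≤ τ x + τ (-x)) :
    (volume K).toReal ≤ 2 * ∫ x in (-X)..X, τ (-x) := by
  have hcont : Continuous fun x => τ x + τ (-x) := by fun_prop
  have hneg : Continuous fun x => τ (-x) := by fun_prop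
  have hint : ∫ x in (-X)..X, (τ x + τ (-x)) = 2 * ∫ x in (-X)..X, τ (-x) := by
    rw [intervalIntegral.integral_add (hτ.intervalIntegrable _ _)
      (hneg.intervalIntegrable _ _)]
    have := intervalIntegral.integral_comp_neg (a := -X) (b := X) τ
    simp only [neg_neg] at this
    rw [this]
    ring
  have hslice : ∀ x, volume (Prod.mk x ⁻¹' K) ≤
      (Set.Icc (-X) X).indicator (fun x => ENNReal.ofReal (τ x + τ (-x))) x := by
    intro x
    by_cases hx : x ∈ Set.Icc (-X) X
    · rw [Set.indicator_of_mem hx]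
      have : Prod.mk x ⁻¹' K ⊆ Set.Icc (-τ (-x)) (τ x) := by
        intro y hy
        have h1 := hKτ _ hy
        have h2 := hKτ _ (hsymm _ hy)
        simp only [Prod.neg_mk] at h1 h2
        exact ⟨by linarith, h1⟩
      refine (measure_mono this).trans ?_
      rw [Real.volume_Icc]
      exact ENNReal.ofReal_le_ofReal (by linarith)
    · rw [Set.indicator_of_notMem hx]
      have : Prod.mk x ⁻¹' K = ∅ := by
        ext y
        simp only [Set.mem_preimage, Set.mem_empty_iff_false, iff_false]
        intro hy
        have h1 := hKX _ hy
        have h2 := hKX _ (hsymm _ hy)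
        simp only [Prod.neg_mk] at h1 h2
        exact hx ⟨by linarith, h1⟩
      simp [this]
  have hvol : volume K ≤ ENNReal.ofReal (∫ x in (-X)..X, (τ x + τ (-x))) := by
    rw [Measure.volume_eq_prod, Measure.prod_apply hK]
    refine (lintegral_mono hslice).trans ?_
    rw [lintegral_indicator measurableSet_Icc,
      intervalIntegral.integral_of_le (by linarith), ← integral_Icc_eq_integral_Ioc,
      ofReal_integral_eq_lintegral_ofReal (hcont.continuousOn.integrableOn_compact isCompact_Icc)]
    exact (ae_restrict_iff' measurableSet_Icc).2 (Filter.Eventually.of_forall hτ0)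
  rw [← hint]
  refine ENNReal.toReal_le_of_le_ofReal ?_ hvol
  exact intervalIntegral.integral_nonneg (by linarith) hτ0

open Finset in
/-- Minkowski's mixed area inequality between a symmetric planar body `K` and the zonogon with
edges `m k • (1, s k)`, for `K` with support numbers at most `h k` in the normal directions. -/
theorem volume_mul_sum_slope_le {K : Set (ℝ × ℝ)} (hK : IsCompact K) (hne : K.Nonempty)
    (hconv : Convex ℝ K) (hsymm : ∀ x ∈ K, -x ∈ K) {n : ℕ} {m s h : ℕ → ℝ}
    (hm : ∀ k < n, 0 ≤ m k) (hR : 0 < ∑ k ∈ range n, m k)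
    (hh : ∀ x ∈ K, ∀ k < n, x.2 - s k * x.1 ≤ h k) (hsum : ∑ k ∈ range n, m k * h k ≤ 1) :
    (volume K).toReal * ∑ j ∈ range n, ∑ i ∈ range j, m i * m j * (s j - s i) ≤ 1 := by
  obtain ⟨q, hq, hmax⟩ := hK.exists_isMaxOn hne continuous_fst.continuousOn
  have hqX : ∀ x ∈ K, x.1 ≤ q.1 := fun x hx => hmax hx
  have hX : 0 ≤ q.1 := by
    have := hqX _ (hsymm _ hq)
    simp only [Prod.fst_neg] at this
    linarith
  have hn : (range n).Nonempty := by
    by_contra hn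
    rw [not_nonempty_iff_eq_empty.1 hn] at hR
    simp at hR
  set τ : ℝ → ℝ := fun x => (range n).inf' hn fun k => h k + s k * x
  have hτ : Continuous τ := by
    apply Continuous.finset_inf'_apply
    intro k _
    fun_prop
  have hτle : ∀ k < n, ∀ x, τ x ≤ h k + s k * x := fun k hk x =>
    inf'_le (fun k => h k + s k * x) (mem_range.2 hk)
  have hKτ : ∀ x ∈ K, x.2 ≤ τ x.1 := by
    intro x hx
    refine le_inf' _ _ fun k hk => ?_
    have := hh x hx k (mem_range.1 hk)
    linarith
  have hτ0 : ∀ x ∈ Set.Icc (-q.1) q.1, 0 ≤ τ x + τ (-x) := by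
    intro x hx
    obtain ⟨y, hy⟩ : ∃ y, (x, y) ∈ K := by
      have : x ∈ segment ℝ (-q.1) q.1 := by rwa [segment_eq_Icc (by linarith)]
      obtain ⟨a, b, ha, hb, hab, rfl⟩ := this
      exact ⟨_, hconv (hsymm _ hq) hq ha hb hab⟩
    have h1 := hKτ _ hy
    have h2 := hKτ _ (hsymm _ hy)
    simp only [Prod.neg_mk] at h1 h2
    linarith
  have hvol := volume_le_two_mul_integral hK.isClosed.measurableSet hX hτ hsymm hqX hKτ hτ0
  set A := (volume K).toReal
  set F := ∑ j ∈ range n, ∑ i ∈ range j, m i * m j * (s j - s i) with hF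
  set R := ∑ k ∈ range n, m k with hRdef
  set z := q.1 / R with hz
  have hz0 : 0 ≤ z := by positivity
  have hzR : z * R = q.1 := by rw [hz]; field_simp
  set b : ℕ → ℝ := fun k => -q.1 + 2 * z * ∑ i ∈ range k, m i with hb
  have hb0 : b 0 = -q.1 := by simp [hb]
  have hbn : b n = q.1 := by
    simp only [hb, ← hRdef]
    linarith
  have hbs : ∀ k, b (k + 1) - b k = 2 * z * m k := by
    intro k
    simp only [hb, sum_range_succ]
    ring
  have hcont : Continuous fun x => τ (-x) := by fun_prop
  have hsplit := intervalIntegral.sum_integral_adjacent_intervals (f := fun x => τ (-x))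
    (μ := volume) (a := b) (n := n) fun k _ => hcont.intervalIntegrable _ _
  have hblock : ∀ k ∈ range n, ∫ x in b k..b (k + 1), τ (-x) ≤ 2 * z * (m k * h k)
      + 2 * z ^ 2 * (s k * m k * (R - (∑ i ∈ range k, m i) - ∑ i ∈ range (k + 1), m i)) := by
    intro k hk
    have hkn := mem_range.1 hk
    have hle : b k ≤ b (k + 1) := by
      have := mul_nonneg (mul_nonneg zero_le_two hz0) (hm k hkn)
      linarith [hbs k]
    calc ∫ x in b k..b (k + 1), τ (-x) ≤ ∫ x in b k..b (k + 1), (h k - s k * x) := by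
          refine intervalIntegral.integral_mono_on hle (hcont.intervalIntegrable _ _)
            (Continuous.intervalIntegrable (by fun_prop) _ _) fun x _ => ?_
          have := hτle k hkn (-x)
          linarith
      _ = h k * (b (k + 1) - b k) - s k * ((b (k + 1) ^ 2 - b k ^ 2) / 2) := by
          rw [intervalIntegral.integral_sub (by simp)
            (Continuous.intervalIntegrable (by fun_prop) _ _),
            intervalIntegral.integral_const_mul, integral_id, intervalIntegral.integral_const,
            smul_eq_mul]
          ring
      _ = _ := by
          have h1 : b (k + 1) ^ 2 - b k ^ 2 = (b (k + 1) - b k) * (b (k + 1) + b k) := by ring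
          rw [h1, hbs]
          simp only [hb, ← hzR]
          ring
  have hint : ∫ x in (-q.1)..q.1, τ (-x) ≤ 2 * z - 2 * z ^ 2 * F := by
    rw [← hb0, ← hbn, ← hsplit]
    refine (sum_le_sum hblock).trans ?_
    rw [sum_add_distrib, ← mul_sum, ← mul_sum, sum_slope_mul_eq, ← hF]
    nlinarith [mul_le_mul_of_nonneg_left hsum hz0]
  have hA : 0 ≤ A := ENNReal.toReal_nonneg
  rcases le_total 0 F with hF0 | hF0
  · nlinarith [sq_nonneg (2 * z * F - 1),
      mul_le_mul_of_nonneg_right (hvol.trans (mul_le_mul_of_nonneg_left hint zero_le_two)) hF0]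
  · nlinarith [mul_nonneg hA (neg_nonneg.2 hF0)]

open Finset in
theorem sum_range_sum_range_eq_two_mul {P : ℕ → ℕ → ℝ} (hP : ∀ i j, P i j = P j i)
    (hP0 : ∀ i, P i i = 0) (n : ℕ) :
    ∑ i ∈ range n, ∑ j ∈ range n, P i j = 2 * ∑ j ∈ range n, ∑ i ∈ range j, P i j := by
  induction n with
  | zero => simp
  | succ n ih =>
    simp only [sum_range_succ, sum_add_distrib, ih, hP0, fun j => hP n j]
    ring

open Finset in
theorem exists_sorted_enumeration (f : ℕ → ℝ) (n : ℕ) :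
    ∃ e : ℕ → ℕ, (∀ k < n, e k < n) ∧
      (∀ G : ℕ → ℝ, ∑ k ∈ range n, G (e k) = ∑ k ∈ range n, G k) ∧
      ∀ i j, i ≤ j → j < n → f (e i) ≤ f (e j) := by
  set σ := Tuple.sort fun i : Fin n => f i
  have hmono := Tuple.monotone_sort fun i : Fin n => f i
  refine ⟨fun k => if h : k < n then σ ⟨k, h⟩ else 0, fun k hk => ?_, fun G => ?_,
    fun i j hij hj => ?_⟩
  · simp [hk]
  · rw [sum_range, sum_range, ← Equiv.sum_comp σ fun i : Fin n => G i]
    simp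
  · have hi := hij.trans_lt hj
    simp only [hi, hj, dif_pos]
    exact hmono (show (⟨i, hi⟩ : Fin n) ≤ ⟨j, hj⟩ from hij)

open Finset in
theorem volume_mul_sum_abs_le_of_ne_zero {K : Set (ℝ × ℝ)} (hK : IsCompact K) (hne : K.Nonempty)
    (hconv : Convex ℝ K) (hsymm : ∀ x ∈ K, -x ∈ K) {n : ℕ} {p a b : ℕ → ℝ}
    (hp : ∀ k < n, 0 ≤ p k) (hsum : ∑ k ∈ range n, p k = 1) (hb : ∀ k < n, b k ≠ 0)
    (hab : ∀ k < n, ∀ x ∈ K, a k * x.1 + b k * x.2 ≤ 1) :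
    (volume K).toReal * ∑ i ∈ range n, ∑ j ∈ range n, p i * p j * |a i * b j - a j * b i| ≤ 2 := by
  obtain ⟨e, hen, hesum, hemono⟩ := exists_sorted_enumeration (fun k => -(a k / b k)) n
  have hR : 0 < ∑ k ∈ range n, p (e k) * |b (e k)| := by
    rw [hesum fun k => p k * |b k|]
    have hnn : ∀ k ∈ range n, 0 ≤ p k * |b k| := fun k hk =>
      mul_nonneg (hp k (mem_range.1 hk)) (abs_nonneg _)
    refine (sum_nonneg hnn).lt_of_ne' fun h0 => ?_
    have hp0 : ∀ k ∈ range n, p k = 0 := fun k hk => by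
      have := (sum_eq_zero_iff_of_nonneg hnn).1 h0 k hk
      simpa [hb k (mem_range.1 hk)] using this
    rw [sum_eq_zero hp0] at hsum
    exact zero_ne_one hsum
  have hmain := volume_mul_sum_slope_le hK hne hconv hsymm (n := n)
    (m := fun k => p (e k) * |b (e k)|) (s := fun k => -(a (e k) / b (e k)))
    (h := fun k => 1 / |b (e k)|)
    (fun k hk => mul_nonneg (hp _ (hen k hk)) (abs_nonneg _)) hR
    (fun x hx k hk => by
      have hbk := hb _ (hen k hk)
      rw [le_div_iff₀ (abs_pos.2 hbk)]
      rcases lt_or_gt_of_ne hbk with h | h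
      · rw [abs_of_neg h]
        have := hab _ (hen k hk) _ (hsymm x hx)
        simp only [Prod.fst_neg, Prod.snd_neg] at this
        field_simp
        linarith
      · rw [abs_of_pos h]
        have := hab _ (hen k hk) x hx
        field_simp
        linarith)
    (by
      rw [hesum fun k => p k * |b k| * (1 / |b k|)]
      refine (sum_congr rfl fun k hk => ?_).trans_le hsum.le
      have := abs_pos.2 (hb k (mem_range.1 hk))
      field_simp)
  have hF : ∑ i ∈ range n, ∑ j ∈ range n, p i * p j * |a i * b j - a j * b i| =
      2 * ∑ j ∈ range n, ∑ i ∈ range j, p (e i) * |b (e i)| * (p (e j) * |b (e j)|) *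
        (-(a (e j) / b (e j)) - -(a (e i) / b (e i))) := by
    rw [← hesum fun i => ∑ j ∈ range n, p i * p j * |a i * b j - a j * b i|]
    simp only [fun i => (hesum fun j => p i * p j * |a i * b j - a j * b i|).symm]
    rw [sum_range_sum_range_eq_two_mul (P := fun i j => p (e i) * p (e j) *
      |a (e i) * b (e j) - a (e j) * b (e i)|)
      (fun i j => by rw [abs_sub_comm, mul_comm (p (e i))]) (fun i => by simp)]
    congr 1
    refine sum_congr rfl fun j hj => sum_congr rfl fun i hi => ?_
    have hjn := mem_range.1 hj
    have hij := mem_range.1 hi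
    have hbi := hb _ (hen i (hij.trans hjn))
    have hbj := hb _ (hen j hjn)
    have h1 := hemono i j hij.le hjn
    have h2 : a (e i) * b (e j) - a (e j) * b (e i) =
        b (e i) * b (e j) * (-(a (e j) / b (e j)) - -(a (e i) / b (e i))) := by
      field_simp
      ring
    rw [h2, abs_mul, abs_mul, abs_of_nonneg (sub_nonneg.2 h1)]
    ring
  rw [hF]
  linarith

open Finset in
theorem volume_mul_sum_abs_le {K : Set (ℝ × ℝ)} (hK : IsCompact K) (hne : K.Nonempty)
    (hconv : Convex ℝ K) (hsymm : ∀ x ∈ K, -x ∈ K) {n : ℕ} {p a b : ℕ → ℝ}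
    (hp : ∀ k < n, 0 ≤ p k) (hsum : ∑ k ∈ range n, p k = 1)
    (hab : ∀ k < n, ∀ x ∈ K, a k * x.1 + b k * x.2 ≤ 1) :
    (volume K).toReal * ∑ i ∈ range n, ∑ j ∈ range n, p i * p j * |a i * b j - a j * b i| ≤ 2 := by
  obtain ⟨C, hC0, hC⟩ := hK.isBounded.exists_pos_norm_le
  set η := 1 / C
  have hη0 : η ≠ 0 := by positivity
  have hη : ∀ x ∈ K, η * x.2 ≤ 1 := by
    intro x hx
    have h1 := (le_abs_self x.2).trans ((norm_snd_le x).trans (hC x hx))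
    rw [one_div_mul_eq_div, div_le_one hC0]
    exact h1
  set F : ℝ → ℝ := fun t => (volume K).toReal * ∑ i ∈ range n, ∑ j ∈ range n, p i * p j *
    |(1 - t) * a i * ((1 - t) * b j + t * η) - (1 - t) * a j * ((1 - t) * b i + t * η)|
  have hF : Continuous F := by fun_prop
  have hlim : Filter.Tendsto F (nhdsWithin 0 (Set.Ioi 0)) (nhds (F 0)) :=
    hF.continuousAt.tendsto.mono_left nhdsWithin_le_nhds
  have hF0 : F 0 = (volume K).toReal *
      ∑ i ∈ range n, ∑ j ∈ range n, p i * p j * |a i * b j - a j * b i| := by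
    simp [F]
  rw [← hF0]
  refine le_of_tendsto hlim ?_
  have hev : ∀ k, ∀ᶠ t in nhdsWithin (0 : ℝ) (Set.Ioi 0), (1 - t) * b k + t * η ≠ 0 := by
    intro k
    rcases eq_or_ne (b k) 0 with h | h
    · filter_upwards [self_mem_nhdsWithin] with t ht
      simpa [h, hη0] using (Set.mem_Ioi.1 ht).ne'
    · refine nhdsWithin_le_nhds ?_
      have : ContinuousAt (fun t => (1 - t) * b k + t * η) 0 := by fun_prop
      exact this.eventually_ne (by simpa using h)
  have hev' : ∀ᶠ t in nhdsWithin (0 : ℝ) (Set.Ioi 0), ∀ k ∈ range n,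
      (1 - t) * b k + t * η ≠ 0 := (Filter.eventually_all_finset _).2 fun k _ => hev k
  filter_upwards [hev', self_mem_nhdsWithin, nhdsWithin_le_nhds (Iio_mem_nhds one_pos)]
    with t ht ht0 ht1
  refine volume_mul_sum_abs_le_of_ne_zero hK hne hconv hsymm hp hsum
    (a := fun k => (1 - t) * a k) (b := fun k => (1 - t) * b k + t * η)
    (fun k hk => ht k (mem_range.2 hk)) fun k hk x hx => ?_
  have h1 := mul_le_mul_of_nonneg_left (hab k hk x hx) (sub_nonneg.2 (Set.mem_Iio.1 ht1).le)
  have h2 := mul_le_mul_of_nonneg_left (hη x hx) (Set.mem_Ioi.1 ht0).le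
  linarith

/-- The linear map `ℝ² → V` sending the standard basis to `v, w`. -/
noncomputable def pairMap {V : Type*} [AddCommGroup V] [Module ℝ V] (v w : V) : ℝ × ℝ →ₗ[ℝ] V :=
  (LinearMap.fst ℝ ℝ ℝ).smulRight v + (LinearMap.snd ℝ ℝ ℝ).smulRight w

@[simp]
theorem pairMap_apply {V : Type*} [AddCommGroup V] [Module ℝ V] (v w : V) (x : ℝ × ℝ) :
    pairMap v w x = x.1 • v + x.2 • w := by
  simp [pairMap]

/-- The signed area of the parallelogram spanned by two vectors of the plane. -/
def cross (p q : ℝ × ℝ) : ℝ := p.1 * q.2 - p.2 * q.1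

theorem det_pairMap (p q : ℝ × ℝ) : LinearMap.det (pairMap p q) = cross p q := by
  have h : pairMap p q = Matrix.toLin (Module.Basis.finTwoProd ℝ) (Module.Basis.finTwoProd ℝ)
      !![p.1, q.1; p.2, q.2] := by
    rw [Matrix.toLin_finTwoProd]
    ext <;> simp
  rw [h, LinearMap.det_toLin, Matrix.det_fin_two_of, cross]
  ring

theorem cross_smul_eq (p q y : ℝ × ℝ) : cross p q • y = cross y q • p + cross p y • q := by
  ext <;> simp [cross] <;> ring

theorem eq_smul_add_smul {p q : ℝ × ℝ} (h : cross p q ≠ 0) (y : ℝ × ℝ) :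
    y = (cross y q / cross p q) • p + (cross p y / cross p q) • q := by
  have := congrArg (fun z => (cross p q)⁻¹ • z) (cross_smul_eq p q y)
  simpa [smul_smul, h, div_eq_inv_mul] using this

/-- The open standard triangle. -/
def openTriangle : Set (ℝ × ℝ) := regionBetween (fun _ => 0) (fun x => 1 - x) (Set.Ioo 0 1)

theorem volume_openTriangle : volume openTriangle = ENNReal.ofReal (1 / 2) := by
  have hc : ContinuousOn (fun x : ℝ => 1 - x) (Set.Icc 0 1) := by fun_prop
  rw [openTriangle, Measure.volume_eq_prod, volume_regionBetween_eq_integral (by simp)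
    (hc.integrableOn_Icc.mono_set Set.Ioo_subset_Icc_self) measurableSet_Ioo
    fun x hx => sub_nonneg.2 hx.2.le]
  congr 1
  rw [← integral_Ioc_eq_integral_Ioo, ← intervalIntegral.integral_of_le zero_le_one]
  simp only [Pi.sub_apply, sub_zero]
  rw [intervalIntegral.integral_sub (by simp) (by simp), integral_id]
  norm_num

theorem isOpen_openTriangle : IsOpen openTriangle := by
  have : openTriangle = {x : ℝ × ℝ | 0 < x.1} ∩ {x | x.1 < 1} ∩ {x | 0 < x.2}
      ∩ {x | x.2 < 1 - x.1} := by
    ext x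
    simp [openTriangle, regionBetween, and_assoc]
  rw [this]
  refine ((IsOpen.inter ?_ ?_).inter ?_).inter ?_
  all_goals exact isOpen_lt (by fun_prop) (by fun_prop)

open Finset in
/-- The area of a half-polygon inscribed in the upper half of a symmetric convex set. -/
theorem sum_cross_le_volume {K : Set (ℝ × ℝ)} (hKm : MeasurableSet K) (hKfin : volume K ≠ ⊤)
    (hconv : Convex ℝ K) (hsymm : ∀ x ∈ K, -x ∈ K) (h0 : 0 ∈ K) {n : ℕ} {x : ℕ → ℝ × ℝ}
    (hxK : ∀ i ≤ n, x i ∈ K) (hx2 : ∀ i ≤ n, 0 ≤ (x i).2)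
    (hpos : ∀ i < n, 0 < cross (x i) (x (i + 1)))
    (hnn : ∀ i j, i ≤ j → j ≤ n → 0 ≤ cross (x i) (x j)) :
    ∑ i ∈ range n, cross (x i) (x (i + 1)) ≤ (volume K).toReal := by
  set T : ℕ → Set (ℝ × ℝ) := fun i => pairMap (x i) (x (i + 1)) '' openTriangle
  have hTvol : ∀ i < n, volume (T i) = ENNReal.ofReal (cross (x i) (x (i + 1)) / 2) := by
    intro i hi
    rw [Measure.addHaar_image_linearMap, det_pairMap, volume_openTriangle, abs_of_pos (hpos i hi),
      ← ENNReal.ofReal_mul (hpos i hi).le]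
    congr 1
    ring
  have hTopen : ∀ i < n, IsOpen (T i) := by
    intro i hi
    refine LinearMap.isOpenMap_of_finiteDimensional _ (fun y => ?_) _ isOpen_openTriangle
    refine ⟨(cross y (x (i + 1)) / cross (x i) (x (i + 1)),
      cross (x i) y / cross (x i) (x (i + 1))), ?_⟩
    rw [pairMap_apply]
    exact (eq_smul_add_smul (hpos i hi).ne' y).symm
  set H : Set (ℝ × ℝ) := {y | 0 < y.2}
  have hH : MeasurableSet H := measurableSet_lt measurable_const measurable_snd
  have hTK : ∀ i < n, T i ⊆ K ∩ H := by
    rintro i hi _ ⟨⟨a, b⟩, ⟨ha, hb⟩, rfl⟩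
    simp only [Set.mem_Ioo] at ha hb
    have h1 := hxK i hi.le
    have h2 := hxK (i + 1) hi
    constructor
    · rw [pairMap_apply]
      have := hconv.sum_mem (t := univ) (w := ![a, b, 1 - a - b]) (z := ![x i, x (i + 1), 0])
        (fun k _ => by fin_cases k <;> simp <;> linarith)
        (by simp [Fin.sum_univ_three])
        (fun k _ => by fin_cases k <;> simp [h0, h1, h2])
      simpa [Fin.sum_univ_three] using this
    · simp only [H, pairMap_apply, Set.mem_ofPred_eq, Prod.snd_add, Prod.smul_snd, smul_eq_mul]
      have h3 := hx2 i hi.le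
      have h4 := hx2 (i + 1) hi
      rcases h3.eq_or_lt with h5 | h5
      · rcases h4.eq_or_lt with h6 | h6
        · have := hpos i hi
          simp [cross, ← h5, ← h6] at this
        · have := mul_pos hb.1 h6
          have := mul_nonneg ha.1.le h3
          linarith
      · have := mul_pos ha.1 h5
        have := mul_nonneg hb.1.le h4
        linarith
  have hdisj : ∀ i j, i < j → j < n → Disjoint (T i) (T j) := by
    intro i j hij hj
    rw [Set.disjoint_left]
    rintro _ ⟨⟨a, b⟩, ⟨ha, hb⟩, rfl⟩ ⟨⟨c, d⟩, ⟨hc, hd⟩, h⟩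
    simp only [Set.mem_Ioo] at ha hb hc hd
    have h1 := hpos i (hij.trans hj)
    have h2 := hnn (i + 1) j hij hj.le
    have h3 := hnn (i + 1) (j + 1) (by omega) hj
    have h4 : c * cross (x (i + 1)) (x j) + d * cross (x (i + 1)) (x (j + 1)) =
        -(a * cross (x i) (x (i + 1))) := by
      have := congrArg (cross (x (i + 1))) h
      simp only [cross, pairMap_apply, Prod.fst_add, Prod.snd_add, Prod.smul_fst, Prod.smul_snd,
        smul_eq_mul] at this ⊢
      linarith
    have := mul_pos ha.1 h1
    have := mul_nonneg hc.1.le h2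
    have := mul_nonneg hd.1.le h3
    linarith
  have hsum : ∑ i ∈ range n, volume (T i) ≤ volume (K ∩ H) := by
    rw [← measure_biUnion_finset]
    · exact measure_mono (Set.iUnion₂_subset fun i hi => hTK i (mem_range.1 hi))
    · intro i hi j hj hij
      have hi' := mem_range.1 hi
      have hj' := mem_range.1 hj
      rcases lt_or_gt_of_ne hij with h | h
      · exact hdisj i j h hj'
      · exact (hdisj j i h hi').symm
    · exact fun i hi => (hTopen i (mem_range.1 hi)).measurableSet
  have hhalf : 2 * volume (K ∩ H) ≤ volume K := by
    have hneg : volume (Neg.neg ⁻¹' (K ∩ H)) = volume (K ∩ H) := Measure.measure_preimage_neg _ _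
    calc 2 * volume (K ∩ H) = volume (K ∩ H) + volume (Neg.neg ⁻¹' (K ∩ H)) := by
          rw [hneg, two_mul]
      _ = volume ((K ∩ H) ∪ Neg.neg ⁻¹' (K ∩ H)) := by
          refine (measure_union ?_ ((hKm.inter hH).preimage measurable_neg)).symm
          rw [Set.disjoint_left]
          rintro y ⟨-, hy⟩ ⟨-, hy'⟩
          simp only [H, Set.mem_ofPred_eq, Prod.snd_neg] at hy hy'
          linarith
      _ ≤ volume K := by
          refine measure_mono (Set.union_subset Set.inter_subset_left ?_)
          rintro y ⟨hy, -⟩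
          simpa using hsymm _ hy
  have htot : ENNReal.ofReal (∑ i ∈ range n, cross (x i) (x (i + 1))) ≤ volume K := by
    refine le_trans ?_ hhalf
    refine le_trans ?_ (mul_le_mul_right hsum 2)
    rw [mul_sum, ENNReal.ofReal_sum_of_nonneg fun i hi => (hpos i (mem_range.1 hi)).le]
    refine (sum_congr rfl fun i hi => ?_).le
    rw [hTvol i (mem_range.1 hi), ← ENNReal.ofReal_ofNat 2, ← ENNReal.ofReal_mul zero_le_two]
    congr 1
    ring
  exact (ENNReal.ofReal_le_iff_le_toReal hKfin).1 htot

open Finset in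
theorem sum_cross_sub_eq (x : ℕ → ℝ × ℝ) (n : ℕ) :
    ∑ j ∈ range n, ∑ i ∈ range j, cross (x (i + 1) - x i) (x (j + 1) - x j) =
      (∑ i ∈ range n, cross (x i) (x (i + 1))) - cross (x 0) (x n) := by
  have h : ∀ (j : ℕ) (y : ℝ × ℝ), ∑ i ∈ range j, cross (x (i + 1) - x i) y =
      cross (x j) y - cross (x 0) y := by
    intro j y
    rw [← sum_range_sub (fun i => cross (x i) y)]
    refine sum_congr rfl fun i _ => ?_
    simp [cross]
    ring
  simp only [h]
  induction n with
  | zero => simp [cross]; ring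
  | succ n ih =>
    rw [sum_range_succ, ih, sum_range_succ]
    simp [cross]
    ring

theorem one_sub_mul_add_le_norm {V : Type*} [NormedAddCommGroup V] [NormedSpace ℝ V] {X Y : V}
    (hX : ‖X‖ = 1) (hY : ‖Y‖ = 1) {δ : ℝ} (hδ : ‖Y - X‖ ≤ δ) (hδ1 : δ ≤ 1) (α β : ℝ) :
    (1 - δ) * (α + β) ≤ ‖α • X + β • Y‖ := by
  have hδ0 : 0 ≤ δ := (norm_nonneg _).trans hδ
  rcases le_total (α + β) 0 with h | h
  · exact (mul_nonpos_of_nonneg_of_nonpos (by linarith) h).trans (norm_nonneg _)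
  have hle : (1 - δ) * (α + β) ≤ α + β := by nlinarith [mul_nonneg hδ0 h]
  have key : |β| - |α| ≤ ‖α • X + β • Y‖ ∧ |α| - |β| ≤ ‖α • X + β • Y‖ := by
    have h1 := norm_sub_norm_le (β • Y) (-(α • X))
    have h2 := norm_sub_norm_le (α • X) (-(β • Y))
    simp only [norm_neg, norm_smul, hX, hY, Real.norm_eq_abs, mul_one, sub_neg_eq_add] at h1 h2
    exact ⟨by rwa [add_comm], h2⟩
  rcases lt_or_ge α 0 with hα | hα
  · have := key.1
    rw [abs_of_neg hα, abs_of_pos (by linarith : 0 < β)] at this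
    linarith
  rcases lt_or_ge β 0 with hβ | hβ
  · have := key.2
    rw [abs_of_neg hβ, abs_of_pos (by linarith : 0 < α)] at this
    linarith
  have h1 : α • X + β • Y = (α + β) • X - β • (X - Y) := by module
  have h2 := norm_sub_norm_le ((α + β) • X) (β • (X - Y))
  rw [← h1, norm_smul, norm_smul, hX, norm_sub_rev, Real.norm_of_nonneg h,
    Real.norm_of_nonneg hβ] at h2
  nlinarith [mul_le_mul_of_nonneg_left hδ hβ, mul_nonneg hδ0 hα]

section NormedPlane

variable {V : Type*} [NormedAddCommGroup V] [NormedSpace ℝ V]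

theorem ker_pairMap {v w : V} (h : LinearIndependent ℝ ![v, w]) : (pairMap v w).ker = ⊥ := by
  rw [LinearMap.ker_eq_bot']
  intro x hx
  rw [pairMap_apply] at hx
  obtain ⟨h1, h2⟩ := LinearIndependent.pair_iff.1 h _ _ hx
  exact Prod.ext h1 h2

theorem continuous_pairMap (v w : V) : Continuous (pairMap v w) := by
  simp only [← funext_iff.2 fun x => (pairMap_apply v w x).symm]
  fun_prop

/-- The closed unit ball of the norm pulled back along `pairMap v w`. -/
def unitRegion (v w : V) : Set (ℝ × ℝ) :=
  {x : ℝ × ℝ | x.1 • v + x.2 • w ∈ Metric.closedBall (0 : V) 1}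

theorem mem_unitRegion {v w : V} {x : ℝ × ℝ} : x ∈ unitRegion v w ↔ ‖pairMap v w x‖ ≤ 1 := by
  simp [unitRegion]

theorem unitRegion_eq_preimage (v w : V) :
    unitRegion v w = pairMap v w ⁻¹' Metric.closedBall 0 1 := by
  ext x
  simp [unitRegion]

theorem convex_unitRegion (v w : V) : Convex ℝ (unitRegion v w) := by
  rw [unitRegion_eq_preimage]
  exact (convex_closedBall 0 1).linear_preimage _

theorem isClosed_unitRegion (v w : V) : IsClosed (unitRegion v w) := by
  rw [unitRegion_eq_preimage]
  exact Metric.isClosed_closedBall.preimage (continuous_pairMap v w)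

theorem isCompact_unitRegion {v w : V} (h : LinearIndependent ℝ ![v, w]) :
    IsCompact (unitRegion v w) := by
  refine Metric.isCompact_of_isClosed_isBounded (isClosed_unitRegion v w) ?_
  obtain ⟨C, -, hC⟩ := LinearMap.exists_antilipschitzWith _ (ker_pairMap h)
  rw [unitRegion_eq_preimage]
  exact hC.isBounded_preimage Metric.isBounded_closedBall

theorem neg_mem_unitRegion {v w : V} : ∀ x ∈ unitRegion v w, -x ∈ unitRegion v w := by
  intro x hx
  rw [mem_unitRegion] at hx ⊢
  rwa [map_neg, norm_neg]

theorem zero_mem_unitRegion (v w : V) : (0 : ℝ × ℝ) ∈ unitRegion v w := by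
  simp [mem_unitRegion]

theorem volume_unitRegion_pos {v w : V} (h : LinearIndependent ℝ ![v, w]) :
    0 < (volume (unitRegion v w)).toReal := by
  refine ENNReal.toReal_pos ?_ (isCompact_unitRegion h).measure_lt_top.ne
  have hopen : IsOpen (pairMap v w ⁻¹' Metric.ball 0 1) :=
    Metric.isOpen_ball.preimage (continuous_pairMap v w)
  refine ((hopen.measure_pos volume ⟨0, by simp⟩).trans_le (measure_mono ?_)).ne'
  rw [unitRegion_eq_preimage]
  exact Set.preimage_mono Metric.ball_subset_closedBall

/-- For dependent vectors, the region is invariant under a linear map of determinant two. -/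
theorem volume_unitRegion_of_not_linearIndependent {v w : V}
    (h : ¬LinearIndependent ℝ ![v, w]) : (volume (unitRegion v w)).toReal = 0 := by
  rw [LinearIndependent.pair_iff] at h
  push Not at h
  obtain ⟨s, t, hst, hne⟩ := h
  have hd : s ^ 2 + t ^ 2 ≠ 0 := by
    intro h0
    have hs : s = 0 := by nlinarith [sq_nonneg s, sq_nonneg t]
    have ht : t = 0 := by nlinarith [sq_nonneg s, sq_nonneg t]
    exact hne hs ht
  set c := (s ^ 2 + t ^ 2)⁻¹ with hc
  have hcd : c * (s ^ 2 + t ^ 2) = 1 := inv_mul_cancel₀ hd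
  set T := pairMap (1 + c * s * s, c * s * t) (c * t * s, 1 + c * t * t)
  have hdet : LinearMap.det T = 2 := by
    rw [det_pairMap, cross]
    linear_combination hcd
  have hT : ∀ x, pairMap v w (T x) = pairMap v w x := by
    intro x
    have : pairMap v w (T x) = pairMap v w x + (c * (s * x.1 + t * x.2)) • (s • v + t • w) := by
      simp only [T, pairMap_apply, Prod.fst_add, Prod.snd_add, Prod.smul_fst, Prod.smul_snd,
        smul_eq_mul]
      module
    rw [this, hst, smul_zero, add_zero]
  have hpre : T ⁻¹' unitRegion v w = unitRegion v w := by
    ext x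
    rw [Set.mem_preimage, mem_unitRegion, mem_unitRegion, hT]
  have hvol := Measure.addHaar_preimage_linearMap volume (f := T) (by rw [hdet]; norm_num)
    (unitRegion v w)
  rw [hpre, hdet] at hvol
  have := congrArg ENNReal.toReal hvol
  rw [ENNReal.toReal_mul, ENNReal.toReal_ofReal (abs_nonneg _), abs_of_pos (by norm_num)] at this
  linarith

theorem exists_dual_extension {v w : V} (h : LinearIndependent ℝ ![v, w]) (φ : ℝ × ℝ →ₗ[ℝ] ℝ)
    (hφ : ∀ u, φ u ≤ ‖pairMap v w u‖) :
    ∃ g : V →ₗ[ℝ] ℝ, (∀ u, g (pairMap v w u) = φ u) ∧ ∀ z, g z ≤ ‖z‖ := by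
  obtain ⟨G, hG⟩ := LinearMap.exists_leftInverse_of_injective _ (ker_pairMap h)
  have hGL : ∀ u, G (pairMap v w u) = u := fun u => LinearMap.congr_fun hG u
  let f : V →ₗ.[ℝ] ℝ := ⟨(pairMap v w).range, (φ.comp G).domRestrict _⟩
  obtain ⟨g, hg, hgN⟩ := exists_extension_of_le_sublinear f (fun z => ‖z‖)
    (fun c hc z => by rw [norm_smul, Real.norm_of_nonneg hc.le]) norm_add_le (by
      rintro ⟨_, ⟨u, rfl⟩⟩
      change φ (G (pairMap v w u)) ≤ _
      rw [hGL]
      exact hφ u)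
  refine ⟨g, fun u => ?_, hgN⟩
  have := hg ⟨pairMap v w u, LinearMap.mem_range_self _ u⟩
  rw [this]
  change φ (G (pairMap v w u)) = _
  rw [hGL]

/-- The unit circle of the pulled-back norm has inscribed half-polygons with short edges. -/
theorem exists_inscribed_half_polygon {v w : V} (h : LinearIndependent ℝ ![v, w]) {δ : ℝ}
    (hδ : 0 < δ) :
    ∃ (n : ℕ) (x : ℕ → ℝ × ℝ), 0 < n ∧ (∀ i, ‖pairMap v w (x i)‖ = 1) ∧ x n = -x 0 ∧
      (∀ i < n, 0 < cross (x i) (x (i + 1))) ∧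
      (∀ i < n, ‖pairMap v w (x (i + 1)) - pairMap v w (x i)‖ ≤ δ) ∧
      (∀ i j, i ≤ j → j ≤ n → 0 ≤ cross (x i) (x j)) ∧ ∀ i ≤ n, 0 ≤ (x i).2 := by
  set u : ℝ → ℝ × ℝ := fun θ => (Real.cos θ, Real.sin θ) with hu
  have hucont : Continuous u := by fun_prop
  have hLu : Continuous fun θ => pairMap v w (u θ) := (continuous_pairMap v w).comp hucont
  have hne : ∀ θ, pairMap v w (u θ) ≠ 0 := by
    intro θ h0
    have := LinearMap.ker_eq_bot'.1 (ker_pairMap h) _ h0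
    have h1 : Real.cos θ = 0 := congrArg Prod.fst this
    have h2 : Real.sin θ = 0 := congrArg Prod.snd this
    have := Real.sin_sq_add_cos_sq θ
    simp [h1, h2] at this
  set r : ℝ → ℝ := fun θ => ‖pairMap v w (u θ)‖⁻¹ with hr
  have hrpos : ∀ θ, 0 < r θ := fun θ => inv_pos.2 (norm_pos_iff.2 (hne θ))
  have hrcont : Continuous r := hLu.norm.inv₀ fun θ => norm_ne_zero_iff.2 (hne θ)
  set γ : ℝ → V := fun θ => pairMap v w (r θ • u θ) with hγ
  have hγcont : Continuous γ := (continuous_pairMap v w).comp (hrcont.smul hucont)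
  have hunif : UniformContinuousOn γ (Set.Icc 0 Real.pi) :=
    isCompact_Icc.uniformContinuousOn_of_continuous hγcont.continuousOn
  obtain ⟨ε, hε, hγε⟩ := Metric.uniformContinuousOn_iff.1 hunif δ hδ
  obtain ⟨n, hn⟩ := exists_nat_gt (max 1 (Real.pi / ε))
  have hn1 : (1 : ℝ) < n := (le_max_left _ _).trans_lt hn
  have hn0 : (0 : ℝ) < n := one_pos.trans hn1
  have hnε : Real.pi / n < ε := by
    have := (le_max_right _ _).trans_lt hn
    rw [div_lt_iff₀ hε] at this
    rw [div_lt_iff₀ hn0]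
    linarith
  have hstep : 0 < Real.pi / n := by positivity
  set θ : ℕ → ℝ := fun i => i * (Real.pi / n) with hθ
  have hθs : ∀ i, θ (i + 1) - θ i = Real.pi / n := by
    intro i
    simp only [hθ]
    push_cast
    ring
  have hθn : θ n = Real.pi := by
    simp only [hθ]
    field_simp
  have hθmono : Monotone θ := monotone_nat_of_le_succ fun i => by linarith [hθs i]
  have hθ0 : θ 0 = 0 := by simp [hθ]
  have hθmem : ∀ i ≤ n, θ i ∈ Set.Icc 0 Real.pi := fun i hi =>
    ⟨hθ0 ▸ hθmono (Nat.zero_le i), hθn ▸ hθmono hi⟩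
  have hcross : ∀ a b, cross (r a • u a) (r b • u b) = r a * r b * Real.sin (b - a) := by
    intro a b
    simp only [cross, hu, Prod.smul_mk, smul_eq_mul, Real.sin_sub]
    ring
  refine ⟨n, fun i => r (θ i) • u (θ i), by exact_mod_cast hn0, fun i => ?_, ?_, fun i hi => ?_,
    fun i hi => ?_, fun i j hij hj => ?_, fun i hi => ?_⟩
  · rw [map_smul, norm_smul, Real.norm_of_nonneg (hrpos _).le]
    exact inv_mul_cancel₀ (norm_ne_zero_iff.2 (hne _))
  · have hpi : u Real.pi = -u 0 := by simp [hu]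
    have hrpi : r Real.pi = r 0 := by simp only [hr, hpi, map_neg, norm_neg]
    simp only [hθn, hθ0, hpi, hrpi, smul_neg]
  · rw [hcross, hθs]
    refine mul_pos (mul_pos (hrpos _) (hrpos _)) (Real.sin_pos_of_pos_of_lt_pi hstep ?_)
    exact div_lt_self Real.pi_pos hn1
  · rw [← dist_eq_norm]
    refine (hγε _ (hθmem _ hi) _ (hθmem _ hi.le) ?_).le
    rwa [Real.dist_eq, hθs, abs_of_pos hstep]
  · rw [hcross]
    refine mul_nonneg (mul_pos (hrpos _) (hrpos _)).le (Real.sin_nonneg_of_nonneg_of_le_pi ?_ ?_)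
    · linarith [hθmono hij]
    · linarith [(hθmem i (hij.trans hj)).1, (hθmem j hj).2]
  · exact mul_nonneg (hrpos _).le (Real.sin_nonneg_of_nonneg_of_le_pi (hθmem i hi).1 (hθmem i hi).2)

end NormedPlane

section Calibration

variable {V : Type*} [NormedAddCommGroup V] [NormedSpace ℝ V]

/-- The exterior product of two linear functionals, as a functional on `⋀²V`. -/
noncomputable def wedgeForm (f g : V →ₗ[ℝ] ℝ) : ⋀[ℝ]^2 V →ₗ[ℝ] ℝ :=
  exteriorPower.alternatingMapLinearEquiv
    ((Matrix.detRowAlternating (n := Fin 2) (R := ℝ)).compLinearMap (LinearMap.pi ![f, g]))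

theorem simpleWedge_eq (v w : V) : simpleWedge v w = exteriorPower.ιMulti ℝ 2 ![v, w] := rfl

theorem wedgeForm_simpleWedge (f g : V →ₗ[ℝ] ℝ) (v w : V) :
    wedgeForm f g (simpleWedge v w) = f v * g w - f w * g v := by
  rw [simpleWedge_eq, wedgeForm, exteriorPower.alternatingMapLinearEquiv_apply_ιMulti]
  change Matrix.det (Matrix.of fun i j : Fin 2 =>
    (LinearMap.pi ![f, g] : V →ₗ[ℝ] Fin 2 → ℝ) (![v, w] i) j) = _
  rw [Matrix.det_fin_two]
  simp
  ring

theorem simpleWedge_of_not_linearIndependent {v w : V} (h : ¬LinearIndependent ℝ ![v, w]) :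
    simpleWedge v w = 0 :=
  (exteriorPower.ιMulti ℝ 2 (M := V)).map_linearDependent _ h

theorem simpleWedge_smul_left (c : ℝ) (v w : V) :
    simpleWedge (c • v) w = c • simpleWedge v w := by
  have h : ∀ x, Function.update ![v, w] 0 x = ![x, w] := fun x => by
    ext i
    fin_cases i <;> rfl
  have := (exteriorPower.ιMulti ℝ 2).map_update_smul ![v, w] 0 c v
  rwa [h, h] at this

/-- The Busemann–Hausdorff area of the parallelogram spanned by `v` and `w`. -/
noncomputable def bhDensity (v w : V) : ℝ := Real.pi / (volume (unitRegion v w)).toReal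

theorem bhDensity_of_not_linearIndependent {v w : V} (h : ¬LinearIndependent ℝ ![v, w]) :
    bhDensity v w = 0 := by
  rw [bhDensity, volume_unitRegion_of_not_linearIndependent h, div_zero]

/-- A functional on `⋀²V` is a calibration if it is dominated by the area density. -/
def IsCalibration (ω : ⋀[ℝ]^2 V →ₗ[ℝ] ℝ) : Prop :=
  ∀ v w : V, ω (simpleWedge v w) ≤ bhDensity v w

open Finset in
theorem isCalibration_sum_wedgeForm {n : ℕ} {p : ℕ → ℝ} {f : ℕ → V →ₗ[ℝ] ℝ}
    (hp : ∀ k < n, 0 ≤ p k) (hsum : ∑ k ∈ range n, p k = 1) (hf : ∀ k < n, ∀ z, f k z ≤ ‖z‖) :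
    IsCalibration (Real.pi • ∑ j ∈ range n, ∑ i ∈ range j,
      (p i * p j) • wedgeForm (f i) (f j)) := by
  intro v w
  by_cases h : LinearIndependent ℝ ![v, w]
  · have hbound := volume_mul_sum_abs_le (isCompact_unitRegion h) ⟨0, zero_mem_unitRegion v w⟩
      (convex_unitRegion v w) neg_mem_unitRegion hp hsum (a := fun k => f k v)
      (b := fun k => f k w) fun k hk x hx => by
        have := (hf k hk _).trans (mem_unitRegion.1 hx)
        rw [pairMap_apply, map_add, map_smul, map_smul, smul_eq_mul, smul_eq_mul] at this
        linarith
    rw [sum_range_sum_range_eq_two_mul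
      (P := fun i j => p i * p j * |f i v * f j w - f j v * f i w|)
      (fun i j => by rw [abs_sub_comm, mul_comm (p i)]) (fun i => by simp)] at hbound
    have hvol := volume_unitRegion_pos h
    have hle : ∑ j ∈ range n, ∑ i ∈ range j, p i * p j * (f i v * f j w - f i w * f j v) ≤
        ∑ j ∈ range n, ∑ i ∈ range j, p i * p j * |f i v * f j w - f j v * f i w| := by
      refine sum_le_sum fun j hj => sum_le_sum fun i hi => ?_
      have hj := mem_range.1 hj
      have hi := mem_range.1 hi
      refine mul_le_mul_of_nonneg_left ?_ (mul_nonneg (hp i (hi.trans hj)) (hp j hj))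
      rw [mul_comm (f j v)]
      exact le_abs_self _
    simp only [LinearMap.smul_apply, LinearMap.sum_apply, wedgeForm_simpleWedge, smul_eq_mul]
    rw [bhDensity, div_eq_mul_one_div]
    refine mul_le_mul_of_nonneg_left (hle.trans ?_) Real.pi_pos.le
    rw [le_div_iff₀ hvol]
    linarith
  · rw [simpleWedge_of_not_linearIndependent h, bhDensity_of_not_linearIndependent h, map_zero]

open Finset in
theorem exists_almost_tight_calibration {v w : V} (h : LinearIndependent ℝ ![v, w]) {δ : ℝ}
    (hδ : 0 < δ) (hδ1 : δ < 1) :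
    ∃ ω : ⋀[ℝ]^2 V →ₗ[ℝ] ℝ, IsCalibration ω ∧
      (1 - δ) ^ 2 * bhDensity v w ≤ ω (simpleWedge v w) := by
  obtain ⟨n, x, hn, hnorm, hxn, hpos, hedge, hnn, hx2⟩ := exists_inscribed_half_polygon h hδ
  set S := ∑ i ∈ range n, cross (x i) (x (i + 1)) with hS
  have hSpos : 0 < S := sum_pos (fun i hi => hpos i (mem_range.1 hi)) ⟨0, mem_range.2 hn⟩
  have hSle : S ≤ (volume (unitRegion v w)).toReal :=
    sum_cross_le_volume (isClosed_unitRegion v w).measurableSet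
      (isCompact_unitRegion h).measure_lt_top.ne (convex_unitRegion v w) neg_mem_unitRegion
      (zero_mem_unitRegion v w) (fun i _ => mem_unitRegion.2 (hnorm i).le) hx2 hpos hnn
  have hext : ∀ i, ∃ g : V →ₗ[ℝ] ℝ, i < n →
      (∀ u, cross (x i) (x (i + 1)) * g (pairMap v w u) =
        (1 - δ) * cross u (x (i + 1) - x i)) ∧ ∀ z, g z ≤ ‖z‖ := by
    intro i
    by_cases hi : i < n
    · have hc := hpos i hi
      set c := cross (x i) (x (i + 1))
      set e := x (i + 1) - x i with he
      let φ : ℝ × ℝ →ₗ[ℝ] ℝ :=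
        ((1 - δ) / c) • (e.2 • LinearMap.fst ℝ ℝ ℝ - e.1 • LinearMap.snd ℝ ℝ ℝ)
      have hφ : ∀ u, φ u = (1 - δ) / c * cross u e := by
        intro u
        simp only [φ, cross, LinearMap.smul_apply, LinearMap.sub_apply, LinearMap.fst_apply,
          LinearMap.snd_apply, smul_eq_mul]
        ring
      obtain ⟨g, hg, hgN⟩ := exists_dual_extension h φ fun u => by
        have h1 := one_sub_mul_add_le_norm (hnorm i) (hnorm (i + 1)) (hedge i hi) hδ1.le
          (cross u (x (i + 1)) / c) (cross (x i) u / c)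
        rw [← map_smul, ← map_smul, ← map_add, ← eq_smul_add_smul hc.ne' u] at h1
        refine le_of_eq_of_le ?_ h1
        rw [hφ, he]
        simp only [cross, Prod.fst_sub, Prod.snd_sub]
        ring
      refine ⟨g, fun _ => ⟨fun u => ?_, hgN⟩⟩
      rw [hg, hφ]
      field_simp
    · exact ⟨0, fun hi' => absurd hi' hi⟩
  choose f hf using hext
  refine ⟨_, isCalibration_sum_wedgeForm (n := n) (p := fun i => cross (x i) (x (i + 1)) / S)
    (f := f) (fun k hk => (div_pos (hpos k hk) hSpos).le) ?_ (fun k hk => (hf k hk).2), ?_⟩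
  · rw [← sum_div, div_self hSpos.ne']
  · have hterm : ∀ j ∈ range n, ∀ i ∈ range j,
        cross (x i) (x (i + 1)) / S * (cross (x j) (x (j + 1)) / S) *
          (f i v * f j w - f i w * f j v) =
        ((1 - δ) / S) ^ 2 * cross (x (i + 1) - x i) (x (j + 1) - x j) := by
      intro j hj i hi
      have hj := mem_range.1 hj
      have hi := (mem_range.1 hi).trans hj
      have hiv := (hf i hi).1 (1, 0)
      have hiw := (hf i hi).1 (0, 1)
      have hjv := (hf j hj).1 (1, 0)
      have hjw := (hf j hj).1 (0, 1)
      simp only [pairMap_apply, one_smul, zero_smul, add_zero, zero_add] at hiv hiw hjv hjw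
      calc _ = (cross (x i) (x (i + 1)) * f i v * (cross (x j) (x (j + 1)) * f j w) -
            cross (x i) (x (i + 1)) * f i w * (cross (x j) (x (j + 1)) * f j v)) / S ^ 2 := by
            ring
        _ = _ := by
            rw [hiv, hiw, hjv, hjw]
            simp only [cross]
            ring
    have hxx : cross (x 0) (x n) = 0 := by
      rw [hxn]
      simp [cross]
      ring
    simp only [LinearMap.smul_apply, LinearMap.sum_apply, wedgeForm_simpleWedge, smul_eq_mul]
    rw [sum_congr rfl fun j hj => sum_congr rfl (hterm j hj)]
    simp only [← mul_sum]
    rw [sum_cross_sub_eq, hxx, sub_zero, ← hS, bhDensity]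
    calc (1 - δ) ^ 2 * (Real.pi / (volume (unitRegion v w)).toReal)
        ≤ (1 - δ) ^ 2 * (Real.pi / S) := by gcongr
      _ = _ := by field_simp

/-- The multiples of the values of all calibrations at a fixed 2-vector are bounded above. -/
theorem exists_forall_isCalibration_le (σ : ⋀[ℝ]^2 V) (c : ℝ) :
    ∃ C : ℝ, ∀ ω : ⋀[ℝ]^2 V →ₗ[ℝ] ℝ, IsCalibration ω → c * ω σ ≤ C := by
  have hσ : σ ∈ Submodule.span ℝ (Set.range (exteriorPower.ιMulti ℝ 2 (M := V))) := by
    rw [exteriorPower.ιMulti_span]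
    trivial
  induction hσ using Submodule.span_induction generalizing c with
  | mem y hy =>
    obtain ⟨m, rfl⟩ := hy
    have hm : exteriorPower.ιMulti ℝ 2 m = simpleWedge (m 0) (m 1) := by
      rw [simpleWedge_eq]
      congr 1
      ext i
      fin_cases i <;> rfl
    refine ⟨bhDensity (c • m 0) (m 1), fun ω hω => ?_⟩
    have := hω (c • m 0) (m 1)
    rwa [simpleWedge_smul_left, map_smul, smul_eq_mul, ← hm] at this
  | zero => exact ⟨0, fun ω _ => by simp⟩
  | add y z _ _ hy hz =>
    obtain ⟨C, hC⟩ := hy c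
    obtain ⟨D, hD⟩ := hz c
    refine ⟨C + D, fun ω hω => ?_⟩
    rw [map_add, mul_add]
    exact add_le_add (hC ω hω) (hD ω hω)
  | smul d y _ hy =>
    obtain ⟨C, hC⟩ := hy (c * d)
    refine ⟨C, fun ω hω => ?_⟩
    rw [map_smul, smul_eq_mul, ← mul_assoc]
    exact hC ω hω

theorem isCalibration_zero : IsCalibration (0 : ⋀[ℝ]^2 V →ₗ[ℝ] ℝ) := fun v w => by
  rw [LinearMap.zero_apply]
  exact div_nonneg Real.pi_pos.le ENNReal.toReal_nonneg

instance : Nonempty {ω : ⋀[ℝ]^2 V →ₗ[ℝ] ℝ // IsCalibration ω} := ⟨⟨0, isCalibration_zero⟩⟩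

/-- The supremum of all calibrations. -/
noncomputable def calibrationSup (σ : ⋀[ℝ]^2 V) : ℝ :=
  ⨆ ω : {ω : ⋀[ℝ]^2 V →ₗ[ℝ] ℝ // IsCalibration ω}, ω.1 σ

theorem le_calibrationSup {ω : ⋀[ℝ]^2 V →ₗ[ℝ] ℝ} (hω : IsCalibration ω) (σ : ⋀[ℝ]^2 V) :
    ω σ ≤ calibrationSup σ := by
  obtain ⟨C, hC⟩ := exists_forall_isCalibration_le σ 1
  refine le_ciSup (f := fun ω : {ω : ⋀[ℝ]^2 V →ₗ[ℝ] ℝ // IsCalibration ω} => ω.1 σ)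
    ⟨C, ?_⟩ ⟨ω, hω⟩
  rintro _ ⟨η, rfl⟩
  simpa using hC η.1 η.2

theorem convexOn_calibrationSup :
    ConvexOn ℝ Set.univ (calibrationSup : ⋀[ℝ]^2 V → ℝ) := by
  refine ⟨convex_univ, fun σ _ τ _ a b ha hb _ => ciSup_le fun ω => ?_⟩
  rw [map_add, map_smul, map_smul]
  exact add_le_add (mul_le_mul_of_nonneg_left (le_calibrationSup ω.2 σ) ha)
    (mul_le_mul_of_nonneg_left (le_calibrationSup ω.2 τ) hb)

theorem calibrationSup_simpleWedge (v w : V) :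
    calibrationSup (simpleWedge v w) = bhDensity v w := by
  refine le_antisymm (ciSup_le fun ω => ω.2 v w) ?_
  by_cases h : LinearIndependent ℝ ![v, w]
  · have hcont : Continuous fun δ : ℝ => (1 - δ) ^ 2 * bhDensity v w := by fun_prop
    have hlim : Filter.Tendsto (fun δ : ℝ => (1 - δ) ^ 2 * bhDensity v w)
        (nhdsWithin 0 (Set.Ioi 0)) (nhds (bhDensity v w)) := by
      have := hcont.continuousAt.tendsto.mono_left
        (nhdsWithin_le_nhds (a := (0 : ℝ)) (s := Set.Ioi 0))
      simpa using this
    refine le_of_tendsto hlim ?_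
    filter_upwards [self_mem_nhdsWithin, nhdsWithin_le_nhds (Iio_mem_nhds one_pos)] with δ hδ hδ1
    obtain ⟨ω, hω, hle⟩ := exists_almost_tight_calibration h (Set.mem_Ioi.1 hδ)
      (Set.mem_Iio.1 hδ1)
    exact hle.trans (le_calibrationSup hω _)
  · rw [bhDensity_of_not_linearIndependent h]
    exact le_calibrationSup isCalibration_zero _

end Calibration

/-- Theorem 1.1 of Burago–Ivanov: in every finite-dimensional normed space `V`, the
two-dimensional Busemann–Hausdorff area density
`A^{bh}(v₁ ∧ v₂) = π / m₂(L⁻¹(B))` (where `L : ℝ² → V` sends the standard basis to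
`v₁, v₂` and `B` is the unit ball) admits a convex extension to `⋀²V`. -/
theorem busemann_hausdorff_density_convex_extension
    (V : Type) [NormedAddCommGroup V] [NormedSpace ℝ V] [FiniteDimensional ℝ V] :
    ∃ g : (⋀[ℝ]^2 V) → ℝ, ConvexOn ℝ Set.univ g ∧
      ∀ v₁ v₂ : V, g (simpleWedge v₁ v₂) =
        Real.pi /
          (volume {x : ℝ × ℝ | x.1 • v₁ + x.2 • v₂ ∈ Metric.closedBall (0 : V) 1}).toReal := by
  exact ⟨calibrationSup, convexOn_calibrationSup, calibrationSup_simpleWedge⟩
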